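/- Suppose m ∈ ℝ, q > 0 and C* > 0 satisfy the horizon condition ∫_{C*}^∞ (Q(s) − 3m + 2q²·P(s))·e^{F(s)}/s⁴ ds = 0. Then m/q ≥ 2√2/3 (in particular m > 0). -/

import Mathlib

open MeasureTheory Real Set Filter

/-- The tail integral `x ↦ ∫ s in Ioi x, g s` has derivative `-g C` at `C`. -/
theorem hasDerivAt_integral_Ioi {g : ℝ → ℝ} (hg : ContinuousOn g (Ioi 0))
    (hi : ∀ C, 0 < C → IntegrableOn g (Ioi C)) {C : ℝ} (hC : 0 < C) :
    HasDerivAt (fun x => ∫ s in Ioi x, g s) (-g C) C := by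
  have hc : 0 < C / 2 := by positivity
  have hii : IntervalIntegrable g volume (C / 2) C :=
    (intervalIntegrable_iff_integrableOn_Ioc_of_le (by linarith)).2
      ((hi _ hc).mono_set Ioc_subset_Ioi_self)
  have hd : HasDerivAt (fun x => ∫ s in (C / 2)..x, g s) (g C) C :=
    intervalIntegral.integral_hasDerivAt_right hii
      (hg.stronglyMeasurableAtFilter isOpen_Ioi C hC) (hg.continuousAt (Ioi_mem_nhds hC))
  refine (hd.const_sub (∫ s in Ioi (C / 2), g s)).congr_of_eventuallyEq ?_
  filter_upwards [Ioi_mem_nhds hC] with x hx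
  have := intervalIntegral.integral_interval_add_Ioi (hi _ hc) (hi x hx)
  linarith

theorem tendsto_integral_Ioi_atTop_zero {g : ℝ → ℝ} {C : ℝ} (hi : IntegrableOn g (Ioi C)) :
    Tendsto (fun x => ∫ s in Ioi x, g s) atTop (nhds 0) := by
  have h := (intervalIntegral_tendsto_integral_Ioi C hi tendsto_id).const_sub (∫ s in Ioi C, g s)
  rw [sub_self] at h
  refine h.congr' ?_
  filter_upwards [eventually_ge_atTop C] with x hx
  have := intervalIntegral.integral_interval_add_Ioi hi (hi.mono_set (Ioi_subset_Ioi hx))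
  simp only [id]
  linarith

theorem integrableOn_Ioi_one_div_pow {C : ℝ} (hC : 0 < C) {n : ℕ} (hn : 2 ≤ n) :
    IntegrableOn (fun s : ℝ => 1 / s ^ n) (Ioi C) := by
  have hn' : (2 : ℝ) ≤ n := by exact_mod_cast hn
  refine (integrableOn_Ioi_rpow_of_lt (a := -(n : ℝ)) (by linarith) hC).congr_fun ?_
    measurableSet_Ioi
  intro s hs
  have hs0 : 0 < s := hC.trans hs
  simp [Real.rpow_neg hs0.le]

/-- If `u = O(s ^ (-3/2 - α))`, then the tail of `∫ u² s` is `O(s ^ (-1 - 2α))`. -/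
theorem integral_Ioi_sq_mul_le {α K C₀ C : ℝ} {u : ℝ → ℝ} (hα : 0 < α) (hC : 0 < C)
    (hCC : C₀ ≤ C) (hbound : ∀ C, C₀ ≤ C → |u C| ≤ K * C ^ (-(3/2 : ℝ) - α))
    (hint : IntegrableOn (fun s => (u s) ^ 2 * s) (Ioi C)) :
    ∫ s in Ioi C, (u s) ^ 2 * s ≤ K ^ 2 / (1 + 2 * α) * C ^ (-1 - 2 * α) := by
  have hi : IntegrableOn (fun s : ℝ => K ^ 2 * s ^ (-2 - 2 * α)) (Ioi C) :=
    (integrableOn_Ioi_rpow_of_lt (by linarith) hC).const_mul _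
  have hle : ∫ s in Ioi C, (u s) ^ 2 * s ≤ ∫ s in Ioi C, K ^ 2 * s ^ (-2 - 2 * α) := by
    refine setIntegral_mono_on hint hi measurableSet_Ioi fun s hs => ?_
    have hs' : C < s := hs
    have hs0 : 0 < s := hC.trans hs'
    have hb := hbound s (hCC.trans hs'.le)
    have hsq : u s ^ 2 ≤ (K * s ^ (-(3/2 : ℝ) - α)) ^ 2 := by
      rw [← sq_abs]
      exact pow_le_pow_left₀ (abs_nonneg _) hb 2
    have hpow : s ^ (-2 - 2 * α) = (s ^ (-(3/2 : ℝ) - α)) ^ 2 * s := by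
      rw [← Real.rpow_mul_natCast hs0.le, ← Real.rpow_add_one hs0.ne']
      congr 1
      push_cast
      ring
    rw [hpow]
    nlinarith [mul_le_mul_of_nonneg_right hsq hs0.le]
  refine hle.trans_eq ?_
  rw [integral_const_mul, integral_Ioi_rpow_of_lt (by linarith) hC]
  have h1 : -2 - 2 * α + 1 = -(1 + 2 * α) := by ring
  have h2 : -1 - 2 * α = -(1 + 2 * α) := by ring
  have h3 : 1 + 2 * α ≠ 0 := by positivity
  rw [h1, h2]
  field_simp

/-- If `w` is positive and continuous with `1 - w ≥ 0` integrable at infinity, then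
`Q = C + ∫ (1 - w)` and `P = ∫ w / s²` satisfy `1 ≤ Q P`. -/
theorem one_le_mul_integral_Ioi {w Q P : ℝ → ℝ} (hw : ContinuousOn w (Ioi 0))
    (hw0 : ∀ s, 0 < w s) (hw1 : ∀ s, 0 < s → w s ≤ 1)
    (hi1 : ∀ C, 0 < C → IntegrableOn (fun s => 1 - w s) (Ioi C))
    (hi2 : ∀ C, 0 < C → IntegrableOn (fun s => w s / s ^ 2) (Ioi C))
    (hQ : ∀ C, Q C = C + ∫ s in Ioi C, (1 - w s)) (hP : ∀ C, P C = ∫ s in Ioi C, w s / s ^ 2)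
    {C : ℝ} (hC : 0 < C) : 1 ≤ Q C * P C := by
  have hQle {x : ℝ} (hx : 0 < x) : x ≤ Q x := by
    rw [hQ]
    linarith [setIntegral_nonneg (μ := volume) (measurableSet_Ioi (a := x))
      fun s hs => sub_nonneg.2 (hw1 s (hx.trans hs))]
  have hQd {x : ℝ} (hx : 0 < x) : HasDerivAt Q (w x) x := by
    rw [funext hQ]
    exact ((hasDerivAt_id x).add (hasDerivAt_integral_Ioi (continuousOn_const.sub hw) hi1
      hx)).congr_deriv (by simp)
  have hPd {x : ℝ} (hx : 0 < x) : HasDerivAt P (-(w x / x ^ 2)) x := by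
    rw [funext hP]
    refine hasDerivAt_integral_Ioi (hw.div (by fun_prop) fun s hs => ?_) hi2 hx
    exact pow_ne_zero 2 (ne_of_gt hs)
  have hd {x : ℝ} (hx : 0 < x) :
      HasDerivAt (fun y => P y - (Q y)⁻¹) (-(w x / x ^ 2) - -w x / Q x ^ 2) x :=
    (hPd hx).sub ((hQd hx).inv (hx.trans_le (hQle hx)).ne')
  have hanti : AntitoneOn (fun y => P y - (Q y)⁻¹) (Ioi 0) := by
    refine antitoneOn_of_deriv_nonpos (convex_Ioi 0)
      (fun x hx => (hd hx).continuousAt.continuousWithinAt) ?_ ?_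
    · intro x hx
      rw [interior_Ioi] at hx
      exact (hd hx).differentiableAt.differentiableWithinAt
    · intro x hx
      rw [interior_Ioi] at hx
      have hx0 : 0 < x := hx
      rw [(hd hx).deriv]
      have h : w x / Q x ^ 2 ≤ w x / x ^ 2 :=
        div_le_div_of_nonneg_left (hw0 x).le (by positivity)
          (pow_le_pow_left₀ hx0.le (hQle hx0) 2)
      rw [neg_div]
      linarith
  have hlim : Tendsto (fun y => P y - (Q y)⁻¹) atTop (nhds 0) := by
    have hPlim : Tendsto P atTop (nhds 0) := by
      rw [funext hP]
      exact tendsto_integral_Ioi_atTop_zero (hi2 C hC)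
    have hQlim : Tendsto Q atTop atTop :=
      tendsto_atTop_mono' atTop ((eventually_gt_atTop 0).mono fun x hx => hQle hx) tendsto_id
    simpa using hPlim.sub hQlim.inv_tendsto_atTop
  have h0 : 0 ≤ P C - (Q C)⁻¹ := by
    refine le_of_tendsto hlim ?_
    filter_upwards [eventually_ge_atTop C] with y hy
    exact hanti hC (hC.trans_le hy : 0 < y) hy
  have hQ0 : 0 < Q C := hC.trans_le (hQle hC)
  have := mul_le_mul_of_nonneg_left (sub_nonneg.1 h0) hQ0.le
  rwa [mul_inv_cancel₀ hQ0.ne'] at this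

theorem stmt_11
    (α : ℝ) (hα : 0 < α)
    (u : ℝ → ℝ) (hu : ContinuousOn u (Set.Ioi 0))
    (K C₀ : ℝ) (hK : 0 < K) (hC₀ : 0 < C₀)
    (hbound : ∀ C, C₀ ≤ C → |u C| ≤ K * C ^ (-(3/2 : ℝ) - α))
    (hint : ∀ C, 0 < C → MeasureTheory.IntegrableOn (fun s => (u s) ^ 2 * s) (Set.Ioi C))
    (F Q P : ℝ → ℝ)
    (hF : ∀ C, F C = -∫ s in Set.Ioi C, (u s) ^ 2 * s)
    (hQ : ∀ C, Q C = C + ∫ s in Set.Ioi C, (1 - Real.exp (F s)))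
    (hP : ∀ C, P C = ∫ s in Set.Ioi C, Real.exp (F s) / s ^ 2)
    (m q Cs : ℝ) (hq : 0 < q) (hCs : 0 < Cs)
    (hhor : ∫ s in Set.Ioi Cs, (Q s - 3 * m + 2 * q ^ 2 * P s) * Real.exp (F s) / s ^ 4 = 0) :
    2 * Real.sqrt 2 / 3 ≤ m / q ∧ 0 < m := by
  have hFc : ContinuousOn F (Ioi 0) := by
    intro x hx
    rw [funext hF]
    exact (hasDerivAt_integral_Ioi ((hu.pow 2).mul continuousOn_id) hint
      hx).neg.continuousAt.continuousWithinAt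
  have hwc : ContinuousOn (fun s => Real.exp (F s)) (Ioi 0) := hFc.rexp
  have hF0 : ∀ s, 0 < s → F s ≤ 0 := fun s hs => by
    rw [hF, neg_nonpos]
    exact setIntegral_nonneg measurableSet_Ioi fun t ht =>
      mul_nonneg (sq_nonneg _) (hs.trans ht).le
  have hw1 : ∀ s, 0 < s → Real.exp (F s) ≤ 1 := fun s hs => Real.exp_le_one_iff.2 (hF0 s hs)
  have hi1 : ∀ C, 0 < C → IntegrableOn (fun s => 1 - Real.exp (F s)) (Ioi C) := fun C hC => by
    have hcont : ContinuousOn (fun s => 1 - Real.exp (F s)) (Ioi 0) := continuousOn_const.sub hwc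
    have hM : 0 < max C C₀ := lt_max_of_lt_left hC
    rw [← Ioc_union_Ioi_eq_Ioi (le_max_left C C₀)]
    refine IntegrableOn.union ?_ ?_
    · refine (ContinuousOn.integrableOn_Icc ?_).mono_set Ioc_subset_Icc_self
      exact hcont.mono fun s hs => hC.trans_le hs.1
    · refine Integrable.mono' ((integrableOn_Ioi_rpow_of_lt (a := -1 - 2 * α)
        (by linarith) hM).const_mul (K ^ 2 / (1 + 2 * α)))
        ((hcont.mono (Ioi_subset_Ioi hM.le)).aestronglyMeasurable measurableSet_Ioi) ?_
      refine (ae_restrict_iff' measurableSet_Ioi).2 (ae_of_all _ fun s hs => ?_)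
      have hs0 : 0 < s := hM.trans hs
      have htail := integral_Ioi_sq_mul_le hα hs0 ((le_max_right C C₀).trans (le_of_lt hs))
        hbound (hint s hs0)
      rw [Real.norm_of_nonneg (sub_nonneg.2 (hw1 s hs0))]
      linarith [Real.add_one_le_exp (F s), hF s]
  have hi_pow : ∀ n, 2 ≤ n → ∀ C, 0 < C →
      IntegrableOn (fun s => Real.exp (F s) / s ^ n) (Ioi C) := fun n hn C hC => by
    refine Integrable.mono' (integrableOn_Ioi_one_div_pow hC hn) (ContinuousOn.aestronglyMeasurable
      ((hwc.mono (Ioi_subset_Ioi hC.le)).div (by fun_prop) fun s hs => ?_) measurableSet_Ioi) ?_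
    · exact pow_ne_zero n (hC.trans hs).ne'
    · refine (ae_restrict_iff' measurableSet_Ioi).2 (ae_of_all _ fun s hs => ?_)
      have hs0 : 0 < s := hC.trans hs
      rw [Real.norm_of_nonneg (by positivity)]
      exact div_le_div_of_nonneg_right (hw1 s hs0) (by positivity)
  have hQP : ∀ C, 0 < C → 1 ≤ Q C * P C := fun C hC =>
    one_le_mul_integral_Ioi hwc (fun s => Real.exp_pos _) hw1 hi1 (hi_pow 2 le_rfl) hQ hP hC
  have hQc : ContinuousOn Q (Ioi 0) := by
    intro x hx
    rw [funext hQ]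
    exact (continuousAt_id.add (hasDerivAt_integral_Ioi (continuousOn_const.sub hwc) hi1
      hx).continuousAt).continuousWithinAt
  have hPc : ContinuousOn P (Ioi 0) := by
    intro x hx
    rw [funext hP]
    refine (hasDerivAt_integral_Ioi (hwc.div (by fun_prop) fun s hs => ?_) (hi_pow 2 le_rfl)
      hx).continuousAt.continuousWithinAt
    exact pow_ne_zero 2 (ne_of_gt hs)
  have hQ0 : ∀ s, 0 < s → 0 < Q s := fun s hs => by
    rw [hQ]
    linarith [setIntegral_nonneg (μ := volume) (measurableSet_Ioi (a := s))
      fun t ht => sub_nonneg.2 (hw1 t (hs.trans ht))]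
  have hQup : ∀ s, Cs < s → Q s ≤ Q Cs * s / Cs := fun s hs => by
    have h0 : 0 ≤ ∫ t in Ioi Cs, (1 - Real.exp (F t)) :=
      setIntegral_nonneg measurableSet_Ioi fun t ht => sub_nonneg.2 (hw1 t (hCs.trans ht))
    have hmono : ∫ t in Ioi s, (1 - Real.exp (F t)) ≤ ∫ t in Ioi Cs, (1 - Real.exp (F t)) :=
      setIntegral_mono_set (hi1 Cs hCs) ((ae_restrict_iff' measurableSet_Ioi).2
        (ae_of_all _ fun t ht => sub_nonneg.2 (hw1 t (hCs.trans ht))))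
        (Ioi_subset_Ioi hs.le).eventuallyLE
    rw [hQ s, hQ Cs, le_div_iff₀ hCs]
    nlinarith
  have hP0 : ∀ s, 0 < s → 0 ≤ P s := fun s hs => by
    rw [hP]
    exact setIntegral_nonneg measurableSet_Ioi fun t ht => by positivity
  have hPup : ∀ s, Cs < s → P s ≤ P Cs := fun s hs => by
    rw [hP, hP]
    exact setIntegral_mono_set (hi_pow 2 le_rfl Cs hCs) (ae_of_all _ fun t => by positivity)
      (Ioi_subset_Ioi hs.le).eventuallyLE
  have hIntegrable : IntegrableOn
      (fun s => (Q s - 3 * m + 2 * q ^ 2 * P s) * Real.exp (F s) / s ^ 4) (Ioi Cs) := by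
    have hsub : Ioi Cs ⊆ Ioi 0 := Ioi_subset_Ioi hCs.le
    refine Integrable.mono' (((hi_pow 3 (by norm_num) Cs hCs).const_mul (Q Cs / Cs)).add
      ((hi_pow 4 (by norm_num) Cs hCs).const_mul (|3 * m| + 2 * q ^ 2 * P Cs)))
      (ContinuousOn.aestronglyMeasurable ?_ measurableSet_Ioi) ?_
    · refine (ContinuousOn.mul ?_ (hwc.mono hsub)).div (by fun_prop) fun s hs =>
        pow_ne_zero 4 (hCs.trans hs).ne'
      exact (((hQc.sub continuousOn_const).add (hPc.const_smul (2 * q ^ 2))).mono hsub)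
    · refine (ae_restrict_iff' measurableSet_Ioi).2 (ae_of_all _ fun s hs => ?_)
      have hs0 : 0 < s := hCs.trans hs
      have hnum : |Q s - 3 * m + 2 * q ^ 2 * P s|
          ≤ Q Cs * s / Cs + (|3 * m| + 2 * q ^ 2 * P Cs) := by
        have h1 := hQup s hs
        have h2 : 2 * q ^ 2 * P s ≤ 2 * q ^ 2 * P Cs :=
          mul_le_mul_of_nonneg_left (hPup s hs) (by positivity)
        have h3 : 0 ≤ 2 * q ^ 2 * P s := mul_nonneg (by positivity) (hP0 s hs0)
        have h4 := hQ0 s hs0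
        have h5 := le_abs_self (3 * m)
        have h6 := neg_abs_le (3 * m)
        exact abs_le.2 ⟨by linarith, by linarith⟩
      rw [Real.norm_eq_abs, abs_div, abs_mul, abs_of_pos (Real.exp_pos _),
        abs_of_pos (pow_pos hs0 4)]
      refine (div_le_div_of_nonneg_right (mul_le_mul_of_nonneg_right hnum (Real.exp_pos _).le)
        (pow_pos hs0 4).le).trans_eq ?_
      simp only [Pi.add_apply]
      field_simp
  have hsqrt : √2 * √2 = 2 := Real.mul_self_sqrt (by norm_num)
  have hsqrt0 : 0 < √2 := by positivity
  have hpt : ∀ s, 0 < s → 2 * √2 * q ≤ Q s + 2 * q ^ 2 * P s := fun s hs => by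
    have h1 := hQP s hs
    have h2 := hQ0 s hs
    have h3 := hP0 s hs
    refine (sq_le_sq₀ (by positivity) (by positivity)).1 ?_
    nlinarith [sq_nonneg (Q s - 2 * q ^ 2 * P s), mul_le_mul_of_nonneg_left h1 (sq_nonneg q)]
  have hJ : 0 < ∫ s in Ioi Cs, Real.exp (F s) / s ^ 4 := by
    refine (setIntegral_pos_iff_support_of_nonneg_ae ?_ (hi_pow 4 (by norm_num) Cs hCs)).2 ?_
    · exact (ae_restrict_iff' measurableSet_Ioi).2 (ae_of_all _ fun t ht => by positivity)
    · rw [inter_eq_right.2 fun s hs => ?_]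
      · simp
      · have hs0 : 0 < s := hCs.trans hs
        exact (div_pos (Real.exp_pos (F s)) (pow_pos hs0 4)).ne'
  have hmain : (2 * √2 * q - 3 * m) * ∫ s in Ioi Cs, Real.exp (F s) / s ^ 4 ≤ 0 := by
    rw [← integral_const_mul, ← hhor]
    refine setIntegral_mono_on ((hi_pow 4 (by norm_num) Cs hCs).const_mul _) hIntegrable
      measurableSet_Ioi fun s hs => ?_
    have hs0 : 0 < s := hCs.trans hs
    rw [mul_div_assoc]
    exact mul_le_mul_of_nonneg_right (by linarith [hpt s hs0]) (by positivity)
  have hle : 2 * √2 * q - 3 * m ≤ 0 := nonpos_of_mul_nonpos_left hmain hJ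
  refine ⟨?_, by nlinarith [mul_pos hsqrt0 hq]⟩
  rw [le_div_iff₀ hq]
  linarith
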